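/- Tauberian counting estimate: Let ν be a non-negative Borel measure on (0,∞) and let α ≥ 1. Assume that ∫₀^∞ e^{-tλ} dν(λ) < ∞ for all t > 0, and that lim_{t→0⁺} t^α ∫₀^∞ e^{-tλ} dν(λ) = c for some c ∈ (0,∞). Then lim_{Λ→∞} ν((0,Λ]) / Λ^α = c / Γ(α+1); equivalently, lim_{t→0⁺} t^α ν((0, 1/t]) = c / Γ(α+1). -/

import Mathlib

open MeasureTheory Filter Topology Set

theorem integrable_mul_comp_of_mem_Icc {Ω : Type*} [MeasurableSpace Ω] {m : Measure Ω}
    {w X : Ω → ℝ} (hw : Integrable w m) (hX : AEStronglyMeasurable X m)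
    (hX01 : ∀ᵐ x ∂m, X x ∈ Icc (0 : ℝ) 1) {h : ℝ → ℝ} (hh : Continuous h) :
    Integrable (fun x => w x * h (X x)) m := by
  obtain ⟨C, hC⟩ := isCompact_Icc.exists_bound_of_continuousOn (s := Icc (0 : ℝ) 1) hh.continuousOn
  exact hw.mul_bdd (c := C) (hh.comp_aestronglyMeasurable hX) (hX01.mono fun x hx => hC _ hx)

theorem abs_integral_mul_comp_sub_le {Ω : Type*} [MeasurableSpace Ω] {m : Measure Ω}
    {w X : Ω → ℝ} (hw : Integrable w m) (hw0 : ∀ᵐ x ∂m, 0 ≤ w x) (hX : AEStronglyMeasurable X m)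
    (hX01 : ∀ᵐ x ∂m, X x ∈ Icc (0 : ℝ) 1) {h p : ℝ → ℝ} (hh : Continuous h) (hp : Continuous p)
    {ε : ℝ} (hε : ∀ x ∈ Icc (0 : ℝ) 1, |p x - h x| ≤ ε) :
    |(∫ x, w x * p (X x) ∂m) - ∫ x, w x * h (X x) ∂m| ≤ ε * ∫ x, w x ∂m := by
  rw [← integral_sub (integrable_mul_comp_of_mem_Icc hw hX hX01 hp)
    (integrable_mul_comp_of_mem_Icc hw hX hX01 hh), ← integral_const_mul]
  rw [← Real.norm_eq_abs]
  refine norm_integral_le_of_norm_le (hw.const_mul ε) ?_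
  filter_upwards [hw0, hX01] with x h0 h1
  rw [← mul_sub, norm_mul, Real.norm_of_nonneg h0, mul_comm]
  exact mul_le_mul_of_nonneg_right (hε _ h1) h0

theorem ae_exp_neg_mul_mem_Icc (m : Measure ℝ) {t : ℝ} (ht : 0 < t) :
    ∀ᵐ l ∂(m.restrict (Ioi 0)), Real.exp (-t * l) ∈ Icc (0 : ℝ) 1 := by
  filter_upwards [ae_restrict_mem measurableSet_Ioi] with l hl
  refine ⟨(Real.exp_pos _).le, Real.exp_le_one_iff.2 ?_⟩
  have : 0 < t * l := mul_pos ht hl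
  linarith

theorem integrableOn_rpow_mul_exp_neg_one_mul {α : ℝ} (hα : 0 < α) :
    IntegrableOn (fun s : ℝ => s ^ (α - 1) * Real.exp (-1 * s)) (Ioi 0) := by
  simpa [mul_comm] using Real.GammaIntegral_convergent hα

section Karamata

variable {ν : Measure ℝ} {α c : ℝ}

theorem tendsto_laplace_polynomial (hα : 0 < α)
    (hfin : ∀ t : ℝ, 0 < t → IntegrableOn (fun l : ℝ => Real.exp (-t * l)) (Ioi 0) ν)
    (hlim : Tendsto (fun t : ℝ => t ^ α * ∫ l in Ioi (0 : ℝ), Real.exp (-t * l) ∂ν)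
      (𝓝[>] 0) (𝓝 c)) (p : Polynomial ℝ) :
    Tendsto (fun t : ℝ => t ^ α * ∫ l in Ioi (0 : ℝ),
        Real.exp (-t * l) * p.eval (Real.exp (-t * l)) ∂ν) (𝓝[>] 0)
      (𝓝 (c / Real.Gamma α * ∫ s in Ioi (0 : ℝ),
        s ^ (α - 1) * Real.exp (-1 * s) * p.eval (Real.exp (-1 * s)))) := by
  have hmeas (m : Measure ℝ) (t : ℝ) : AEStronglyMeasurable (fun l : ℝ => Real.exp (-t * l)) m :=
    Continuous.aestronglyMeasurable (by fun_prop)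
  induction p using Polynomial.induction_on' with
  | add p q hp hq =>
    have hI := integrableOn_rpow_mul_exp_neg_one_mul hα
    have hsum := hp.add hq
    rw [← mul_add, ← integral_add
      (integrable_mul_comp_of_mem_Icc hI (hmeas _ 1) (ae_exp_neg_mul_mem_Icc _ one_pos) p.continuous)
      (integrable_mul_comp_of_mem_Icc hI (hmeas _ 1) (ae_exp_neg_mul_mem_Icc _ one_pos)
        q.continuous)] at hsum
    simp only [Polynomial.eval_add, mul_add (_ * _ : ℝ)]
    refine hsum.congr' ?_
    filter_upwards [self_mem_nhdsWithin] with t ht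
    rw [← mul_add, ← integral_add
      (integrable_mul_comp_of_mem_Icc (hfin t ht) (hmeas _ t) (ae_exp_neg_mul_mem_Icc _ ht)
        p.continuous)
      (integrable_mul_comp_of_mem_Icc (hfin t ht) (hmeas _ t) (ae_exp_neg_mul_mem_Icc _ ht)
        q.continuous)]
    simp only [mul_add]
  | monomial n a =>
    have hn : (0 : ℝ) < n + 1 := by positivity
    have hexp (t l : ℝ) : Real.exp (-t * l) * Real.exp (-t * l) ^ n
        = Real.exp (-((n + 1) * t) * l) := by
      rw [← Real.exp_nat_mul, ← Real.exp_add]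
      ring_nf
    have hlimit : c / Real.Gamma α * ∫ s in Ioi (0 : ℝ),
        s ^ (α - 1) * Real.exp (-1 * s) * (Polynomial.monomial n a).eval (Real.exp (-1 * s))
        = a * ((n : ℝ) + 1)⁻¹ ^ α * c := by
      have heq (s : ℝ) : s ^ (α - 1) * Real.exp (-1 * s)
            * (Polynomial.monomial n a).eval (Real.exp (-1 * s))
          = a * (s ^ (α - 1) * Real.exp (-(((n : ℝ) + 1) * s))) := by
        have := hexp 1 s
        rw [mul_one, neg_mul (n + 1 : ℝ)] at this
        rw [Polynomial.eval_monomial, ← this]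
        ring
      simp_rw [heq]
      rw [integral_const_mul, Real.integral_rpow_mul_exp_neg_mul_Ioi hα hn, one_div]
      have := (Real.Gamma_pos_of_pos hα).ne'
      field_simp
    rw [hlimit]
    have hscale : Tendsto (fun t : ℝ => ((n : ℝ) + 1) * t) (𝓝[>] 0) (𝓝[>] 0) := by
      refine tendsto_nhdsWithin_iff.2 ⟨?_, ?_⟩
      · have : Continuous (fun t : ℝ => ((n : ℝ) + 1) * t) := by fun_prop
        simpa using (this.tendsto 0).mono_left nhdsWithin_le_nhds
      · filter_upwards [self_mem_nhdsWithin] with t ht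
        exact mul_pos hn ht
    refine ((hlim.comp hscale).const_mul (a * ((n : ℝ) + 1)⁻¹ ^ α)).congr' ?_
    filter_upwards [self_mem_nhdsWithin] with t ht
    have heq (l : ℝ) : Real.exp (-t * l) * (Polynomial.monomial n a).eval (Real.exp (-t * l))
        = a * Real.exp (-((n + 1) * t) * l) := by
      rw [Polynomial.eval_monomial, ← hexp]
      ring
    simp_rw [heq]
    rw [integral_const_mul, Function.comp_apply, Real.mul_rpow hn.le (le_of_lt ht),
      Real.inv_rpow hn.le]
    have := (Real.rpow_pos_of_pos hn α).ne'
    field_simp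

theorem tendsto_laplace_continuous (hα : 0 < α)
    (hfin : ∀ t : ℝ, 0 < t → IntegrableOn (fun l : ℝ => Real.exp (-t * l)) (Ioi 0) ν)
    (hlim : Tendsto (fun t : ℝ => t ^ α * ∫ l in Ioi (0 : ℝ), Real.exp (-t * l) ∂ν)
      (𝓝[>] 0) (𝓝 c)) {h : ℝ → ℝ} (hh : Continuous h) :
    Tendsto (fun t : ℝ => t ^ α * ∫ l in Ioi (0 : ℝ),
        Real.exp (-t * l) * h (Real.exp (-t * l)) ∂ν) (𝓝[>] 0)
      (𝓝 (c / Real.Gamma α * ∫ s in Ioi (0 : ℝ),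
        s ^ (α - 1) * Real.exp (-1 * s) * h (Real.exp (-1 * s)))) := by
  have hmeas (m : Measure ℝ) (t : ℝ) : AEStronglyMeasurable (fun l : ℝ => Real.exp (-t * l)) m :=
    Continuous.aestronglyMeasurable (by fun_prop)
  have hΓ := Real.Gamma_pos_of_pos hα
  have hc : 0 ≤ c := by
    refine ge_of_tendsto hlim ?_
    filter_upwards [self_mem_nhdsWithin] with t ht
    exact mul_nonneg (Real.rpow_nonneg (le_of_lt ht) _)
      (integral_nonneg fun _ => (Real.exp_pos _).le)
  have hGamma : ∫ s in Ioi (0 : ℝ), s ^ (α - 1) * Real.exp (-1 * s) = Real.Gamma α := by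
    have := Real.integral_rpow_mul_exp_neg_mul_Ioi hα one_pos
    simpa using this
  rw [Metric.tendsto_nhds]
  intro ε hε
  obtain ⟨p, hp⟩ := exists_polynomial_near_of_continuousOn 0 1 h hh.continuousOn
    (ε / (3 * (c + 1))) (by positivity)
  have hp' : ∀ x ∈ Icc (0 : ℝ) 1, |p.eval x - h x| ≤ ε / (3 * (c + 1)) :=
    fun x hx => (hp x hx).le
  have hL := abs_integral_mul_comp_sub_le (integrableOn_rpow_mul_exp_neg_one_mul hα)
    (by
      filter_upwards [ae_restrict_mem measurableSet_Ioi] with s hs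
      exact mul_nonneg (Real.rpow_nonneg (le_of_lt hs) _) (Real.exp_pos _).le)
    (hmeas _ 1) (ae_exp_neg_mul_mem_Icc _ one_pos) hh p.continuous hp'
  rw [hGamma] at hL
  filter_upwards [self_mem_nhdsWithin, hlim.eventually_lt_const (lt_add_one c),
    Metric.tendsto_nhds.1 (tendsto_laplace_polynomial hα hfin hlim p) (ε / 3) (by positivity)]
    with t ht htc htp
  have hLt := abs_integral_mul_comp_sub_le (hfin t ht) (ae_of_all _ fun _ => (Real.exp_pos _).le)
    (hmeas _ t) (ae_exp_neg_mul_mem_Icc _ ht) hh p.continuous hp'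
  have htα : 0 < t ^ α := Real.rpow_pos_of_pos ht _
  rw [Real.dist_eq] at htp ⊢
  have h1 := mul_le_mul_of_nonneg_left hLt htα.le
  rw [← abs_of_pos htα, ← abs_mul, abs_of_pos htα, mul_sub] at h1
  have h2 := mul_le_mul_of_nonneg_left hL (div_nonneg hc hΓ.le)
  rw [← abs_of_nonneg (div_nonneg hc hΓ.le), ← abs_mul, abs_of_nonneg (div_nonneg hc hΓ.le),
    mul_sub] at h2
  have h3 : t ^ α * (ε / (3 * (c + 1)) * ∫ l in Ioi (0 : ℝ), Real.exp (-t * l) ∂ν) ≤ ε / 3 := by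
    calc _ = ε / (3 * (c + 1)) * (t ^ α * ∫ l in Ioi (0 : ℝ), Real.exp (-t * l) ∂ν) := by ring
      _ ≤ ε / (3 * (c + 1)) * (c + 1) := by gcongr
      _ = ε / 3 := by field_simp
  have h4 : c / Real.Gamma α * (ε / (3 * (c + 1)) * Real.Gamma α) ≤ ε / 3 := by
    calc _ = ε / (3 * (c + 1)) * c := by field_simp
      _ ≤ ε / (3 * (c + 1)) * (c + 1) := by gcongr; linarith
      _ = ε / 3 := by field_simp
  rw [abs_le] at h1 h2
  rw [abs_lt] at htp ⊢
  constructor <;> linarith [h1.1, h1.2, h2.1, h2.2, htp.1, htp.2]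

/-- A continuous function whose product with `x` is a ramp from `0` at `p` to `1` at `q`. -/
noncomputable def rampDiv (p q x : ℝ) : ℝ := max 0 (min 1 ((x - p) / (q - p))) / max x p

theorem continuous_rampDiv {p : ℝ} (hp : 0 < p) (q : ℝ) : Continuous (rampDiv p q) := by
  unfold rampDiv
  exact Continuous.div (by fun_prop) (by fun_prop) fun x => (lt_max_of_lt_right hp).ne'

theorem mul_rampDiv_of_le {p q x : ℝ} (hpq : p < q) (hx : x ≤ p) : x * rampDiv p q x = 0 := by
  have : (x - p) / (q - p) ≤ 0 := div_nonpos_of_nonpos_of_nonneg (by linarith) (by linarith)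
  rw [rampDiv, max_eq_left ((min_le_right _ _).trans this), zero_div, mul_zero]

theorem mul_rampDiv_of_ge {p q x : ℝ} (hp : 0 < p) (hpq : p < q) (hx : q ≤ x) :
    x * rampDiv p q x = 1 := by
  have : 1 ≤ (x - p) / (q - p) := (one_le_div (by linarith)).2 (by linarith)
  have hx0 : x ≠ 0 := by linarith
  rw [rampDiv, min_eq_left this, max_eq_right zero_le_one, max_eq_left (by linarith)]
  field_simp

theorem mul_rampDiv_nonneg {p q x : ℝ} (hp : 0 < p) (hx : 0 ≤ x) : 0 ≤ x * rampDiv p q x :=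
  mul_nonneg hx (div_nonneg (le_max_left _ _) (hp.le.trans (le_max_right _ _)))

theorem mul_rampDiv_le_one {p q x : ℝ} (hp : 0 < p) (hx : 0 ≤ x) : x * rampDiv p q x ≤ 1 := by
  have hm : 0 < max x p := lt_max_of_lt_right hp
  have h1 : max 0 (min 1 ((x - p) / (q - p))) ≤ 1 := max_le zero_le_one (min_le_left _ _)
  rw [rampDiv, mul_div_assoc', div_le_one hm]
  nlinarith [le_max_left x p, le_max_left 0 (min 1 ((x - p) / (q - p)))]

theorem indicator_le_exp_mul_rampDiv {a b : ℝ} (hab : a < b) (s : ℝ) :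
    (Ioc 0 a).indicator (fun _ => (1 : ℝ)) s
      ≤ Real.exp (-s) * rampDiv (Real.exp (-b)) (Real.exp (-a)) (Real.exp (-s)) := by
  by_cases hs : s ∈ Ioc 0 a
  · rw [indicator_of_mem hs, mul_rampDiv_of_ge (Real.exp_pos _)
      (Real.exp_lt_exp.2 (neg_lt_neg hab)) (Real.exp_le_exp.2 (neg_le_neg hs.2))]
  · rw [indicator_of_notMem hs]
    exact mul_rampDiv_nonneg (Real.exp_pos _) (Real.exp_pos _).le

theorem exp_mul_rampDiv_le_indicator {a b s : ℝ} (hab : a < b) (hs0 : 0 < s) :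
    Real.exp (-s) * rampDiv (Real.exp (-b)) (Real.exp (-a)) (Real.exp (-s))
      ≤ (Ioc 0 b).indicator (fun _ => (1 : ℝ)) s := by
  by_cases hs : s ≤ b
  · rw [indicator_of_mem (show s ∈ Ioc 0 b from ⟨hs0, hs⟩)]
    exact mul_rampDiv_le_one (Real.exp_pos _) (Real.exp_pos _).le
  · rw [indicator_of_notMem (fun h => hs h.2)]
    exact (mul_rampDiv_of_le (Real.exp_lt_exp.2 (neg_lt_neg hab))
      (Real.exp_le_exp.2 (neg_le_neg (not_le.1 hs).le))).le

theorem integrableOn_rpow_mul_indicator (hα : 0 < α) (b : ℝ) :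
    IntegrableOn (fun s : ℝ => s ^ (α - 1) * (Ioc 0 b).indicator (fun _ => (1 : ℝ)) s)
      (Ioi 0) := by
  have h : (fun s : ℝ => s ^ (α - 1) * (Ioc 0 b).indicator (fun _ => (1 : ℝ)) s)
      = (Ioc 0 b).indicator fun s => s ^ (α - 1) := by
    ext s
    by_cases hs : s ∈ Ioc 0 b <;> simp [hs]
  rw [h]
  refine Integrable.integrableOn ((integrable_indicator_iff measurableSet_Ioc).2 ?_)
  rcases le_total 0 b with hb | hb
  · exact (intervalIntegrable_iff_integrableOn_Ioc_of_le hb).1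
      (intervalIntegral.intervalIntegrable_rpow' (by linarith))
  · simp [Ioc_eq_empty (not_lt.2 hb)]

theorem integral_rpow_mul_indicator (hα : 0 < α) {b : ℝ} (hb : 0 ≤ b) :
    ∫ s in Ioi (0 : ℝ), s ^ (α - 1) * (Ioc 0 b).indicator (fun _ => (1 : ℝ)) s
      = b ^ α / α := by
  have h (s : ℝ) : s ^ (α - 1) * (Ioc 0 b).indicator (fun _ => (1 : ℝ)) s
      = (Ioc 0 b).indicator (fun s => s ^ (α - 1)) s := by
    by_cases hs : s ∈ Ioc 0 b <;> simp [hs]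
  simp_rw [h]
  rw [setIntegral_indicator measurableSet_Ioc, inter_eq_right.2 Ioc_subset_Ioi_self,
    ← intervalIntegral.integral_of_le hb, integral_rpow (Or.inl (by linarith))]
  simp [Real.zero_rpow hα.ne']

theorem integrableOn_indicator_mul
    (hfin : ∀ t : ℝ, 0 < t → IntegrableOn (fun l : ℝ => Real.exp (-t * l)) (Ioi 0) ν)
    {t : ℝ} (ht : 0 < t) :
    IntegrableOn (fun l : ℝ => (Ioc 0 1).indicator (fun _ => (1 : ℝ)) (t * l)) (Ioi 0) ν := by
  refine Integrable.mono' ((hfin t ht).const_mul (Real.exp 1)) ?_ (ae_of_all _ fun l => ?_)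
  · exact ((measurable_const.indicator measurableSet_Ioc).comp
      (measurable_const_mul t)).aestronglyMeasurable
  · by_cases hl : t * l ∈ Ioc (0 : ℝ) 1
    · rw [indicator_of_mem hl, ← Real.exp_add, norm_one, Real.one_le_exp_iff]
      linarith [hl.2]
    · rw [indicator_of_notMem hl, norm_zero]
      positivity

theorem integral_indicator_mul {t : ℝ} (ht : 0 < t) :
    ∫ l in Ioi (0 : ℝ), (Ioc 0 1).indicator (fun _ => (1 : ℝ)) (t * l) ∂ν
      = (ν (Ioc 0 (1 / t))).toReal := by
  have h (l : ℝ) : (Ioc 0 1).indicator (fun _ => (1 : ℝ)) (t * l)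
      = (Ioc 0 (1 / t)).indicator 1 l := by
    have : t * l ∈ Ioc (0 : ℝ) 1 ↔ l ∈ Ioc 0 (1 / t) := by
      rw [mem_Ioc, mem_Ioc, le_div_iff₀ ht, mul_comm l t, mul_pos_iff_of_pos_left ht]
    by_cases hl : l ∈ Ioc 0 (1 / t)
    · rw [indicator_of_mem hl, indicator_of_mem (this.2 hl), Pi.one_apply]
    · rw [indicator_of_notMem hl, indicator_of_notMem (mt this.1 hl)]
  simp_rw [h]
  rw [integral_indicator_one measurableSet_Ioc, measureReal_restrict_apply measurableSet_Ioc,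
    inter_eq_left.2 Ioc_subset_Ioi_self, measureReal_def]

theorem tendsto_rpow_mul_measure_Ioc (hα : 0 < α)
    (hfin : ∀ t : ℝ, 0 < t → IntegrableOn (fun l : ℝ => Real.exp (-t * l)) (Ioi 0) ν)
    (hlim : Tendsto (fun t : ℝ => t ^ α * ∫ l in Ioi (0 : ℝ), Real.exp (-t * l) ∂ν)
      (𝓝[>] 0) (𝓝 c)) :
    Tendsto (fun t : ℝ => t ^ α * (ν (Ioc 0 (1 / t))).toReal) (𝓝[>] 0)
      (𝓝 (c / Real.Gamma (α + 1))) := by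
  have hmeas (m : Measure ℝ) (t : ℝ) : AEStronglyMeasurable (fun l : ℝ => Real.exp (-t * l)) m :=
    Continuous.aestronglyMeasurable (by fun_prop)
  have hc : 0 ≤ c := by
    refine ge_of_tendsto hlim ?_
    filter_upwards [self_mem_nhdsWithin] with t ht
    exact mul_nonneg (Real.rpow_nonneg (le_of_lt ht) _)
      (integral_nonneg fun _ => (Real.exp_pos _).le)
  have hcΓ : 0 ≤ c / Real.Gamma α := div_nonneg hc (Real.Gamma_pos_of_pos hα).le
  have hconst (b : ℝ) : c / Real.Gamma α * (b ^ α / α) = c / Real.Gamma (α + 1) * b ^ α := by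
    rw [Real.Gamma_add_one hα.ne']
    have := (Real.Gamma_pos_of_pos hα).ne'
    field_simp
  have hcont : ContinuousAt (fun b : ℝ => c / Real.Gamma (α + 1) * b ^ α) 1 :=
    continuousAt_const.mul (Real.continuousAt_rpow_const 1 α (Or.inl one_ne_zero))
  have h_int (a b : ℝ) {t : ℝ} (ht : 0 < t) :
      IntegrableOn (fun l => Real.exp (-t * l)
        * rampDiv (Real.exp (-b)) (Real.exp (-a)) (Real.exp (-t * l))) (Ioi 0) ν :=
    integrable_mul_comp_of_mem_Icc (hfin t ht) (hmeas _ t) (ae_exp_neg_mul_mem_Icc _ ht)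
      (continuous_rampDiv (Real.exp_pos _) _)
  have h_int' (a b : ℝ) :
      IntegrableOn (fun s : ℝ => s ^ (α - 1) * Real.exp (-1 * s)
        * rampDiv (Real.exp (-b)) (Real.exp (-a)) (Real.exp (-1 * s))) (Ioi 0) :=
    integrable_mul_comp_of_mem_Icc (integrableOn_rpow_mul_exp_neg_one_mul hα) (hmeas _ 1)
      (ae_exp_neg_mul_mem_Icc _ one_pos) (continuous_rampDiv (Real.exp_pos _) _)
  have hramp (a b : ℝ) := tendsto_laplace_continuous hα hfin hlim
    (continuous_rampDiv (Real.exp_pos (-b)) (Real.exp (-a)))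
  refine tendsto_order.2 ⟨fun y hy => ?_, fun y hy => ?_⟩
  · have hev : ∀ᶠ b in 𝓝[<] (1 : ℝ), y < c / Real.Gamma (α + 1) * b ^ α :=
      (hcont.eventually (lt_mem_nhds (by simpa using hy))).filter_mono nhdsWithin_le_nhds
    obtain ⟨a, ⟨hya, ha1⟩, ha0⟩ := ((hev.and self_mem_nhdsWithin).and
      ((lt_mem_nhds (zero_lt_one' ℝ)).filter_mono nhdsWithin_le_nhds)).exists
    have hlow : y < c / Real.Gamma α * ∫ s in Ioi (0 : ℝ), s ^ (α - 1) * Real.exp (-1 * s)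
        * rampDiv (Real.exp (-1)) (Real.exp (-a)) (Real.exp (-1 * s)) := by
      refine hya.trans_le ?_
      rw [← hconst, ← integral_rpow_mul_indicator hα (le_of_lt ha0)]
      refine mul_le_mul_of_nonneg_left (setIntegral_mono_on
        (integrableOn_rpow_mul_indicator hα a) (h_int' a 1) measurableSet_Ioi fun s hs => ?_) hcΓ
      rw [mul_assoc, neg_one_mul]
      exact mul_le_mul_of_nonneg_left (indicator_le_exp_mul_rampDiv ha1 s)
        (Real.rpow_nonneg (le_of_lt hs) _)
    filter_upwards [self_mem_nhdsWithin, (hramp a 1).eventually_const_lt hlow] with t ht hyt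
    refine hyt.trans_le (mul_le_mul_of_nonneg_left ?_ (Real.rpow_nonneg (le_of_lt ht) _))
    rw [← integral_indicator_mul ht]
    refine setIntegral_mono_on (h_int a 1 ht) (integrableOn_indicator_mul hfin ht)
      measurableSet_Ioi fun l hl => ?_
    rw [neg_mul]
    exact exp_mul_rampDiv_le_indicator ha1 (mul_pos ht hl)
  · have hev : ∀ᶠ b in 𝓝[>] (1 : ℝ), c / Real.Gamma (α + 1) * b ^ α < y :=
      (hcont.eventually (gt_mem_nhds (by simpa using hy))).filter_mono nhdsWithin_le_nhds
    obtain ⟨b, hyb, hb1⟩ := (hev.and self_mem_nhdsWithin).exists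
    have hb1 : 1 < b := hb1
    have hup : c / Real.Gamma α * (∫ s in Ioi (0 : ℝ), s ^ (α - 1) * Real.exp (-1 * s)
        * rampDiv (Real.exp (-b)) (Real.exp (-1)) (Real.exp (-1 * s))) < y := by
      refine lt_of_le_of_lt ?_ hyb
      rw [← hconst, ← integral_rpow_mul_indicator hα (by linarith)]
      refine mul_le_mul_of_nonneg_left (setIntegral_mono_on (h_int' 1 b)
        (integrableOn_rpow_mul_indicator hα b) measurableSet_Ioi fun s hs => ?_) hcΓ
      rw [mul_assoc, neg_one_mul]
      exact mul_le_mul_of_nonneg_left (exp_mul_rampDiv_le_indicator hb1 hs)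
        (Real.rpow_nonneg (le_of_lt hs) _)
    filter_upwards [self_mem_nhdsWithin, (hramp 1 b).eventually_lt_const hup] with t ht hyt
    refine lt_of_le_of_lt (mul_le_mul_of_nonneg_left ?_ (Real.rpow_nonneg (le_of_lt ht) _)) hyt
    rw [← integral_indicator_mul ht]
    refine setIntegral_mono_on (integrableOn_indicator_mul hfin ht) (h_int 1 b ht)
      measurableSet_Ioi fun l _ => ?_
    rw [neg_mul]
    exact indicator_le_exp_mul_rampDiv hb1 (t * l)

end Karamata

/-- Tauberian counting estimate. -/
theorem tauberian_counting
    (ν : Measure ℝ) (α : ℝ) (hα : 1 ≤ α) (c : ℝ) (hc : 0 < c)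
    (hfin : ∀ t : ℝ, 0 < t →
      IntegrableOn (fun l : ℝ => Real.exp (-t * l)) (Set.Ioi 0) ν)
    (hlim : Tendsto
      (fun t : ℝ => t ^ α * ∫ l in Set.Ioi (0:ℝ), Real.exp (-t * l) ∂ν)
      (𝓝[>] 0) (𝓝 c)) :
    Tendsto (fun Λ : ℝ => (ν (Set.Ioc 0 Λ)).toReal / Λ ^ α) atTop
        (𝓝 (c / Real.Gamma (α + 1)))
    ∧ Tendsto (fun t : ℝ => t ^ α * (ν (Set.Ioc 0 (1 / t))).toReal) (𝓝[>] 0)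
        (𝓝 (c / Real.Gamma (α + 1))) := by
  have h := tendsto_rpow_mul_measure_Ioc (zero_lt_one.trans_le hα) hfin hlim
  refine ⟨(h.comp tendsto_inv_atTop_nhdsGT_zero).congr' ?_, h⟩
  filter_upwards [eventually_gt_atTop 0] with Λ hΛ
  rw [Function.comp_apply, Real.inv_rpow hΛ.le, one_div, inv_inv, inv_mul_eq_div]
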